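/- Let k be a field of characteristic ≠ 2, let M be a semi-simple module with M¹ = 0, and let q be a quadratic space over k with dim(q) = dim_k(M). Then q has an isometry with module M if and only if the Witt index of q is at least m₂, where 2m₂ = dim_k(M²). -/

import Mathlib

open Polynomial

noncomputable section

variable {k : Type} [Field k]

/-- `f*(X) = f(0)⁻¹ X^{deg f} f(1/X)`. -/
def starPoly (f : k[X]) : k[X] := Polynomial.C (f.coeff 0)⁻¹ * f.reverse

/-- Type 0 : a product of powers of `X - 1` and `X + 1`. -/
def IsType0Pol (f : k[X]) : Prop := ∃ a b : ℕ, f = (X - 1 : k[X]) ^ a * (X + 1) ^ b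

/-- Type 1 : a product of (powers of) monic symmetric irreducible polynomials of even degree. -/
def IsType1Pol (f : k[X]) : Prop :=
  ∃ s : Multiset k[X],
    (∀ g ∈ s, g.Monic ∧ Irreducible g ∧ g = g.reverse ∧ Even g.natDegree) ∧ f = s.prod

/-- Type 2 : a product of polynomials `g * g*` with `g` monic irreducible, `g ≠ ±g*`. -/
def IsType2Pol (f : k[X]) : Prop :=
  ∃ s : Multiset k[X],
    (∀ g ∈ s, g.Monic ∧ Irreducible g ∧ g ≠ starPoly g ∧ g ≠ -starPoly g) ∧
    f = (s.map fun g => g * starPoly g).prod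

/-- A monic polynomial is hyperbolic if it is of the form `G·G*`; equivalently, all its
components of type 0 and 1 occur with an even exponent. -/
def IsHyperbolicPoly (f : k[X]) : Prop := ∃ g : k[X], g.Monic ∧ f = g * starPoly g

/-- Data describing a self-dual torsion `k[X]`-module which is finite dimensional over `k`:
the direct sum, over `i`, of `[k[X]/(f i ^ e i)]^(n i)`, where each `f i` is monic
irreducible, and where the collection is self-dual (stable under `f ↦ f*`). -/
structure ModuleData (k : Type) [Field k] where
  ι : Type
  [fin : Fintype ι]
  f : ι → k[X]
  e : ι → ℕ
  n : ι → ℕ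
  monic : ∀ i, (f i).Monic
  irr : ∀ i, Irreducible (f i)
  epos : ∀ i, 0 < e i
  npos : ∀ i, 0 < n i
  selfdual : ∃ σ : Equiv.Perm ι,
    ∀ i, f (σ i) = starPoly (f i) ∧ e (σ i) = e i ∧ n (σ i) = n i

attribute [instance] ModuleData.fin

namespace ModuleData

variable (D : ModuleData k)

/-- The underlying `K[X]`-module of `M ⊗_k K`, realised concretely, for an extension
`ι : k →+* K`. -/
abbrev SpaceVia {K : Type} [Field K] (ι : k →+* K) : Type :=
  (i : D.ι) → Fin (D.n i) →
    (Polynomial K ⧸ Ideal.span {((D.f i).map ι) ^ D.e i})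

/-- The dimension of `M` as a `k`-vector space. -/
def dim : ℕ := ∑ i, D.n i * (D.e i * (D.f i).natDegree)

/-- The characteristic polynomial `F_M` of `M`. -/
def charPoly : k[X] := ∏ i, D.f i ^ (D.n i * D.e i)

/-- The summand `i` is of type 0 : `f i` is `X - 1` or `X + 1`. -/
def IsIdx0 (i : D.ι) : Prop := D.f i = X - 1 ∨ D.f i = X + 1

/-- The summand `i` is of type 1 : `f i` is symmetric of even degree. -/
def IsIdx1 (i : D.ι) : Prop := D.f i = (D.f i).reverse ∧ Even (D.f i).natDegree

/-- The summand `i` is of type 2 : `f i` is not self-dual. -/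
def IsIdx2 (i : D.ι) : Prop := D.f i ≠ starPoly (D.f i)

open Classical in
/-- `dim_k M⁰`. -/
def dim0 : ℕ := ∑ i, if D.IsIdx0 i then D.n i * (D.e i * (D.f i).natDegree) else 0

open Classical in
/-- `dim_k M¹`. -/
def dim1 : ℕ := ∑ i, if D.IsIdx1 i then D.n i * (D.e i * (D.f i).natDegree) else 0

open Classical in
/-- `dim_k M²`. -/
def dim2 : ℕ := ∑ i, if D.IsIdx2 i then D.n i * (D.e i * (D.f i).natDegree) else 0

/-- `M` is semi-simple : all exponents are 1. -/
def Semisimple : Prop := ∀ i, D.e i = 1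

/-- `M̄_odd` : the direct sum of the summands `[k[X]/(f)]^n`, over those summands
`[k[X]/(f^e)]^n` of `M` with `e` odd and `f` self-dual (`f = f*`). -/
def oddBar : ModuleData k where
  ι := {i : D.ι // Odd (D.e i) ∧ D.f i = starPoly (D.f i)}
  fin := by classical exact inferInstance
  f i := D.f i.1
  e _ := 1
  n i := D.n i.1
  monic i := D.monic i.1
  irr i := D.irr i.1
  epos _ := one_pos
  npos i := D.npos i.1
  selfdual := ⟨Equiv.refl _, fun i => ⟨i.2.2, rfl, rfl⟩⟩

end ModuleData

theorem starPoly_eq_self_of_symm {f : k[X]} (hm : f.Monic) (hs : f = f.reverse) :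
    starPoly f = f := by
  have h0 : f.coeff 0 = 1 := by
    conv_lhs => rw [hs]
    rw [Polynomial.coeff_zero_reverse]
    exact hm
  rw [starPoly, h0, inv_one, map_one, one_mul, ← hs]

/-- The module `[k[X]/(f)]^m` for a monic symmetric irreducible `f`. -/
def ModuleData.single (f : k[X]) (hmon : f.Monic) (hirr : Irreducible f)
    (hsym : f = f.reverse) (m : ℕ) (hm : 0 < m) : ModuleData k where
  ι := Unit
  fin := inferInstance
  f _ := f
  e _ := 1
  n _ := m
  monic _ := hmon
  irr _ := hirr
  epos _ := one_pos
  npos _ := hm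
  selfdual := ⟨Equiv.refl _, fun _ => ⟨(starPoly_eq_self_of_symm hmon hsym).symm, rfl, rfl⟩⟩

section Bilin

variable {V : Type} [AddCommGroup V] [Module k V]

/-- `t` is an isometry of the bilinear space `(V, B)`. -/
def IsIsometryOf (B : LinearMap.BilinForm k V) (t : V ≃ₗ[k] V) : Prop :=
  ∀ x y, B (t x) (t y) = B x y

/-- `(V, B)` is a quadratic space : `B` is a symmetric bilinear form of non-zero
determinant (equivalently, non-degenerate). -/
def IsQuadraticSpace (B : LinearMap.BilinForm k V) : Prop :=
  (∀ x y, B x y = B y x) ∧ (∀ x, (∀ y, B x y = 0) → x = 0)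

/-- The bilinear space `(W, B)` over an extension `ι : k →+* K` has an isometry whose
associated `K[X]`-module is `M ⊗_k K`. -/
def HasIsometryWithModuleVia {K : Type} [Field K] (ι : k →+* K)
    {W : Type} [AddCommGroup W] [Module K W]
    (B : LinearMap.BilinForm K W) (D : ModuleData k) : Prop :=
  ∃ t : W ≃ₗ[K] W, IsIsometryOf B t ∧
    ∃ φ : W ≃ₗ[K] D.SpaceVia ι, ∀ w, φ (t w) = (X : Polynomial K) • φ w

/-- `(V, B)` has an isometry with module `M`. -/
def HasIsometryWithModule (B : LinearMap.BilinForm k V) (D : ModuleData k) : Prop :=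
  HasIsometryWithModuleVia (RingHom.id k) B D

/-- The bilinear space `(W, B)` over an extension `ι : k →+* K` has an isometry with
minimal polynomial (the image of) `f`. -/
def HasIsometryWithMinpolyVia {K : Type} [Field K] (ι : k →+* K)
    {W : Type} [AddCommGroup W] [Module K W]
    (B : LinearMap.BilinForm K W) (f : k[X]) : Prop :=
  ∃ t : W ≃ₗ[K] W, IsIsometryOf B t ∧ minpoly K t.toLinearMap = f.map ι

/-- `(V, B)` has an isometry with minimal polynomial `f`. -/
def HasIsometryWithMinpoly (B : LinearMap.BilinForm k V) (f : k[X]) : Prop :=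
  ∃ t : V ≃ₗ[k] V, IsIsometryOf B t ∧ minpoly k t.toLinearMap = f

/-- A (2n)-dimensional quadratic space is hyperbolic if it has a self-orthogonal subspace
of dimension n. -/
def IsHyperbolicSpace (B : LinearMap.BilinForm k V) : Prop :=
  ∃ W : Submodule k V, (∀ x ∈ W, ∀ y ∈ W, B x y = 0) ∧
    2 * Module.finrank k W = Module.finrank k V

/-- The Witt index : the largest dimension of a totally isotropic subspace. -/
def wittIndex (B : LinearMap.BilinForm k V) : ℕ :=
  sSup {m | ∃ W : Submodule k V, (∀ x ∈ W, ∀ y ∈ W, B x y = 0) ∧ Module.finrank k W = m}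

variable [FiniteDimensional k V]

/-- The Gram matrix of `B` with respect to a fixed basis. -/
def gramOf (B : LinearMap.BilinForm k V) :
    Matrix (Fin (Module.finrank k V)) (Fin (Module.finrank k V)) k :=
  LinearMap.toMatrix₂ (Module.finBasis k V) (Module.finBasis k V) B

/-- The determinant of `B` (well defined modulo nonzero squares). -/
def detOf (B : LinearMap.BilinForm k V) : k := (gramOf B).det

end Bilin

section StarPoly

theorem starPoly_starPoly {f : k[X]} (hm : f.Monic) (h0 : f.coeff 0 ≠ 0) :
    starPoly (starPoly f) = f := by
  have hrr : f.reverse.reverse = f := by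
    rw [reverse, reverse_natDegree, natTrailingDegree_eq_zero.2 (Or.inr h0), tsub_zero, reverse,
      reflect_reflect]
  have hc : (starPoly f).coeff 0 = (f.coeff 0)⁻¹ := by
    rw [starPoly, coeff_C_mul, coeff_zero_reverse, hm.leadingCoeff, mul_one]
  rw [starPoly, hc, starPoly, reverse_mul_of_domain, reverse_C, hrr, ← mul_assoc, ← C_mul,
    inv_inv, mul_inv_cancel₀ h0, C_1, one_mul]

theorem natDegree_starPoly {f : k[X]} (h0 : f.coeff 0 ≠ 0) :
    (starPoly f).natDegree = f.natDegree := by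
  rw [starPoly, natDegree_C_mul (inv_ne_zero h0), reverse_natDegree,
    natTrailingDegree_eq_zero.2 (Or.inr h0), tsub_zero]

theorem reverse_eq_C_mul_starPoly {f : k[X]} (h0 : f.coeff 0 ≠ 0) :
    f.reverse = C (f.coeff 0) * starPoly f := by
  rw [starPoly, ← mul_assoc, ← C_mul, mul_inv_cancel₀ h0, C_1, one_mul]

theorem isCoprime_reverse_iff {f g : k[X]} (h0 : f.coeff 0 ≠ 0) :
    IsCoprime g f.reverse ↔ IsCoprime g (starPoly f) := by
  rw [reverse_eq_C_mul_starPoly h0]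
  exact isCoprime_mul_unit_left_right (isUnit_C.2 h0.isUnit) _ _

theorem eq_X_sub_C_of_irreducible_of_isRoot {f : k[X]} (hm : f.Monic) (hi : Irreducible f)
    {a : k} (ha : f.IsRoot a) : f = X - C a :=
  (eq_of_monic_of_associated (monic_X_sub_C a) hm
    ((irreducible_X_sub_C a).associated_of_dvd hi (dvd_iff_isRoot.2 ha))).symm

/-- A self-dual monic irreducible polynomial which is not symmetric of even degree is `X - 1` or
`X + 1`. -/
theorem exists_eq_X_sub_C_of_eq_starPoly (hchar : (2 : k) ≠ 0) {f : k[X]} (hm : f.Monic)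
    (hi : Irreducible f) (h0 : f.coeff 0 ≠ 0) (hs : f = starPoly f)
    (h1 : ¬ (f = f.reverse ∧ Even f.natDegree)) : ∃ ε : k, ε * ε = 1 ∧ f = X - C ε := by
  have hc : f.coeff 0 = (f.coeff 0)⁻¹ := by
    conv_lhs => rw [hs]
    rw [starPoly, coeff_C_mul, coeff_zero_reverse, hm.leadingCoeff, mul_one]
  have hrev := reverse_eq_C_mul_starPoly h0
  rw [← hs] at hrev
  have hev (x : k) (hx : x * x = 1) :
      f.coeff 0 * f.eval x * x ^ f.natDegree = f.eval x := by
    let : Invertible x := ⟨x, hx, hx⟩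
    have := eval₂_reverse_mul_pow (RingHom.id k) x f
    change eval₂ (RingHom.id k) x _ * _ = _ at this
    rw [hrev] at this
    simpa [eval₂_id] using this
  have hc' : f.coeff 0 * f.coeff 0 = 1 := by
    nth_rw 2 [hc]
    exact mul_inv_cancel₀ h0
  rcases mul_self_eq_one_iff.1 hc' with h | h
  · have hodd : Odd f.natDegree := by
      rw [← Nat.not_even_iff_odd]
      exact fun he => h1 ⟨by rw [hrev, h, C_1, one_mul], he⟩
    have := hev (-1) (by ring)
    rw [h, hodd.neg_one_pow] at this
    have h2 : 2 * f.eval (-1) = 0 := by linear_combination -this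
    exact ⟨-1, by ring, eq_X_sub_C_of_irreducible_of_isRoot hm hi
      ((mul_eq_zero.1 h2).resolve_left hchar)⟩
  · have := hev 1 (by ring)
    rw [h, one_pow] at this
    have h2 : 2 * f.eval 1 = 0 := by linear_combination -this
    exact ⟨1, by ring, eq_X_sub_C_of_irreducible_of_isRoot hm hi
      ((mul_eq_zero.1 h2).resolve_left hchar)⟩

end StarPoly

section Endomorphism

variable {M N : Type} [AddCommGroup M] [Module k M] [AddCommGroup N] [Module k N]

/-- If `b (s x) (t y) = b x y` then the adjoint of `p(s)` is, up to a power of `t`, the reversed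
polynomial evaluated at `t`. -/
theorem pairing_aeval_reverse (b : M →ₗ[k] N →ₗ[k] k) (s : Module.End k M) (t : Module.End k N)
    (hb : ∀ x y, b (s x) (t y) = b x y) (p : k[X]) (x : M) (y : N) :
    b (aeval s p x) ((t ^ p.natDegree) y) = b x (aeval t p.reverse y) := by
  have hpow (n : ℕ) (x : M) (y : N) : b ((s ^ n) x) ((t ^ n) y) = b x y := by
    induction n generalizing x y with
    | zero => rfl
    | succ n ih => rw [pow_succ', pow_succ', Module.End.mul_apply, Module.End.mul_apply, hb, ih]
  rw [reverse]
  suffices h : ∀ N, p.natDegree ≤ N →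
      b (aeval s p x) ((t ^ N) y) = b x (aeval t (reflect N p) y) from h _ le_rfl
  intro N hN
  refine induction_with_natDegree_le
    (fun p => b (aeval s p x) ((t ^ N) y) = b x (aeval t (reflect N p) y)) N ?_ ?_ ?_ p hN
  · simp
  · intro n r _ hn
    rw [reflect_C_mul_X_pow, revAt_le hn]
    nth_rw 1 [← Nat.add_sub_of_le hn]
    simp only [pow_add, map_mul, aeval_C, map_pow, aeval_X, Module.End.mul_apply,
      Module.algebraMap_end_apply, map_smul, LinearMap.smul_apply, hpow]
  · intro f g _ _ hf hg
    rw [reflect_add, map_add, map_add, LinearMap.add_apply, LinearMap.add_apply, map_add, map_add,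
      LinearMap.add_apply, hf, hg]

theorem apply_eq_zero_of_aeval_eq_zero (b : M →ₗ[k] M →ₗ[k] k) (t : Module.End k M)
    (hb : ∀ x y, b (t x) (t y) = b x y) {p : k[X]} (hp : IsCoprime p p.reverse) {x y : M}
    (hx : aeval t p x = 0) (hy : aeval t p y = 0) : b x y = 0 := by
  obtain ⟨u, v, huv⟩ := hp
  have hy' : aeval t p.reverse (aeval t v y) = y := by
    have := congrArg (fun q => aeval t q y) huv
    simp only [map_add, map_mul, LinearMap.add_apply, Module.End.mul_apply, hy, map_zero, zero_add,
      map_one, Module.End.one_apply] at this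
    rw [← Module.End.mul_apply, ← map_mul, mul_comm, map_mul, Module.End.mul_apply, this]
  rw [← hy', ← pairing_aeval_reverse b t t hb, hx, map_zero, LinearMap.zero_apply]

theorem apply_aeval_of_intertwines {Q : Type} [AddCommGroup Q] [Module k Q] [Module k[X] Q]
    [IsScalarTower k k[X] Q] (e : M →ₗ[k] Q) (t : Module.End k M)
    (he : ∀ v, e (t v) = (X : k[X]) • e v) (p : k[X]) (v : M) : e (aeval t p v) = p • e v := by
  induction p using Polynomial.induction_on generalizing v with
  | C a => rw [aeval_C, Module.algebraMap_end_apply, map_smul, ← algebraMap_eq, algebraMap_smul]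
  | add p q hp hq => rw [map_add, LinearMap.add_apply, map_add, hp, hq, add_smul]
  | monomial n a h =>
    rw [pow_succ, ← mul_assoc, map_mul, aeval_X, Module.End.mul_apply, h, he, smul_smul]

theorem injective_of_aeval_eq_zero (s : Module.End k M) {p : k[X]} (hp : aeval s p = 0)
    (h0 : p.coeff 0 ≠ 0) : Function.Injective s := by
  rw [injective_iff_map_eq_zero]
  intro x hx
  have := congrArg (fun q => aeval s q x) (divX_mul_X_add p)
  simp only [map_add, map_mul, aeval_X, LinearMap.add_apply, Module.End.mul_apply, hx, map_zero,
    zero_add, hp, LinearMap.zero_apply, aeval_C, Module.algebraMap_end_apply] at this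
  exact (smul_eq_zero.1 this).resolve_left h0

/-- A finite dimensional space with an endomorphism killed by an irreducible polynomial `g` is, as
a `k[X]`-module, a sum of copies of `k[X]/(g)`. -/
theorem exists_equiv_pi_quotient [FiniteDimensional k M] (t : Module.End k M) {g : k[X]}
    (hg : Irreducible g) (ht : aeval t g = 0) {n : ℕ}
    (hn : Module.finrank k M = n * g.natDegree) {I : Ideal k[X]} (hI : I = Ideal.span {g}) :
    ∃ e : M ≃ₗ[k] (Fin n → k[X] ⧸ I), ∀ v, e (t v) = (X : k[X]) • e v := by
  have hmax : I.IsMaximal := hI ▸ PrincipalIdealRing.isMaximal_of_irreducible hg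
  let : Field (k[X] ⧸ I) := Ideal.Quotient.field I
  let ψ : (k[X] ⧸ I) →ₐ[k] Module.End k M := Ideal.Quotient.liftₐ I (aeval t) (by
    intro a ha
    rw [hI, Ideal.mem_span_singleton] at ha
    obtain ⟨b, rfl⟩ := ha
    rw [map_mul, ht, zero_mul])
  let : Module (k[X] ⧸ I) M := Module.compHom M ψ.toRingHom
  have hsmul (l : k[X] ⧸ I) (m : M) : l • m = ψ l m := rfl
  have : IsScalarTower k (k[X] ⧸ I) M := ⟨fun c l m => by
    rw [hsmul, hsmul, map_smul, LinearMap.smul_apply]⟩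
  have : FiniteDimensional (k[X] ⧸ I) M := Module.Finite.of_restrictScalars_finite k _ _
  have hL : Module.finrank k (k[X] ⧸ I) = g.natDegree := by
    rw [hI]
    exact finrank_quotient_span_eq_natDegree
  have hfr : Module.finrank (k[X] ⧸ I) M = n := by
    have h := Module.finrank_mul_finrank k (k[X] ⧸ I) M
    rw [hL, hn, mul_comm] at h
    exact Nat.eq_of_mul_eq_mul_right hg.natDegree_pos h
  let e := (Module.finBasisOfFinrankEq (k[X] ⧸ I) M hfr).equivFun
  refine ⟨e.restrictScalars k, fun v => ?_⟩
  have hX : t v = Ideal.Quotient.mk I X • v := by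
    rw [hsmul]
    exact (congrArg (fun q : Module.End k M => q v) (aeval_X t)).symm
  rw [LinearEquiv.restrictScalars_apply, hX, map_smul]
  rfl

end Endomorphism

section Witt

variable {V A : Type} [AddCommGroup V] [Module k V] [FiniteDimensional k V]
  [AddCommGroup A] [Module k A] [FiniteDimensional k A]

theorem finrank_le_wittIndex (B : LinearMap.BilinForm k V) (W : Submodule k V)
    (hW : ∀ x ∈ W, ∀ y ∈ W, B x y = 0) : Module.finrank k W ≤ wittIndex B := by
  refine le_csSup ⟨Module.finrank k V, ?_⟩ ⟨W, hW, rfl⟩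
  rintro _ ⟨W', -, rfl⟩
  exact W'.finrank_le

theorem exists_isotropic_finrank_eq (B : LinearMap.BilinForm k V) {m : ℕ}
    (hm : m ≤ wittIndex B) :
    ∃ W : Submodule k V, (∀ x ∈ W, ∀ y ∈ W, B x y = 0) ∧ Module.finrank k W = m := by
  obtain ⟨W, hW, hWf⟩ : wittIndex B ∈ {m | ∃ W : Submodule k V,
      (∀ x ∈ W, ∀ y ∈ W, B x y = 0) ∧ Module.finrank k W = m} := by
    refine Nat.sSup_mem ⟨0, ⊥, by simp, by simp⟩ ⟨Module.finrank k V, ?_⟩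
    rintro _ ⟨W', -, rfl⟩
    exact W'.finrank_le
  obtain ⟨f, hf⟩ := exists_linearIndependent_of_le_finrank (R := k) (M := W) (hWf ▸ hm)
  have hf' := hf.map' W.subtype W.ker_subtype
  refine ⟨Submodule.span k (Set.range (W.subtype ∘ f)), ?_, ?_⟩
  · have hle : Submodule.span k (Set.range (W.subtype ∘ f)) ≤ W := by
      rw [Submodule.span_le]
      rintro _ ⟨i, rfl⟩
      exact (f i).2
    exact fun x hx y hy => hW x (hle hx) y (hle hy)
  · rw [finrank_span_eq_card hf', Fintype.card_fin]

/-- A totally isotropic embedding of `A` extends to a hyperbolic embedding of `A × A^∨`. -/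
theorem exists_isotropic_dual (hchar : (2 : k) ≠ 0) (B : LinearMap.BilinForm k V)
    (hq : IsQuadraticSpace B) (α : A →ₗ[k] V) (hα : Function.Injective α)
    (hiso : ∀ a b, B (α a) (α b) = 0) :
    ∃ β : Module.Dual k A →ₗ[k] V, (∀ f a, B (β f) (α a) = f a) ∧
      ∀ f g, B (β f) (β g) = 0 := by
  have hsurj : Function.Surjective (α.dualMap ∘ₗ B) := by
    refine (LinearMap.dualMap_surjective_of_injective hα).comp ?_
    refine (LinearMap.injective_iff_surjective_of_finrank_eq_finrank
      Subspace.dual_finrank_eq.symm).1 ?_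
    rw [injective_iff_map_eq_zero]
    intro x hx
    exact hq.2 x fun y => by rw [hx, LinearMap.zero_apply]
  obtain ⟨p, hp⟩ := (α.dualMap ∘ₗ B).exists_rightInverse_of_surjective
    (LinearMap.range_eq_top.2 hsurj)
  have hp' (f : Module.Dual k A) (a : A) : B (p f) (α a) = f a :=
    congrArg (fun q : Module.Dual k A →ₗ[k] Module.Dual k A => q f a) hp
  let r : Module.Dual k A →ₗ[k] A :=
    (Module.evalEquiv k A).symm.toLinearMap ∘ₗ (p.dualMap ∘ₗ B ∘ₗ p)
  have hr (f g : Module.Dual k A) : g (r f) = B (p f) (p g) :=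
    Module.apply_evalEquiv_symm_apply ..
  refine ⟨p - (2 : k)⁻¹ • α ∘ₗ r, fun f a => ?_, fun f g => ?_⟩
  · simp [hp', hiso]
  · simp only [LinearMap.sub_apply, LinearMap.smul_apply, LinearMap.comp_apply, map_sub, map_smul,
      hp', hiso, hr, hq.1 (α _) (p _), hq.1 (p g) (p f), smul_eq_mul]
    field_simp
    ring

/-- Witt decomposition of a quadratic space with respect to a totally isotropic embedding, the
orthogonal complement of the hyperbolic part being written in diagonal form. -/
theorem exists_witt_decomposition (hchar : (2 : k) ≠ 0) (B : LinearMap.BilinForm k V)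
    (hq : IsQuadraticSpace B) (α : A →ₗ[k] V) (hα : Function.Injective α)
    (hiso : ∀ a b, B (α a) (α b) = 0) {J : Type} [Fintype J]
    (hJ : Module.finrank k V = 2 * Module.finrank k A + Fintype.card J) :
    ∃ (c : J → k) (Φ : V ≃ₗ[k] (A × Module.Dual k A) × (J → k)), ∀ x y,
      B x y = (Φ x).1.2 (Φ y).1.1 + (Φ y).1.2 (Φ x).1.1
        + ∑ j, c j * (Φ x).2 j * (Φ y).2 j := by
  obtain ⟨β, hβα, hβ⟩ := exists_isotropic_dual hchar B hq α hα hiso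
  have hrefl : B.IsRefl := fun x y h => by rw [hq.1, h]
  let h : A × Module.Dual k A →ₗ[k] V := α.coprod β
  have hB (x y : A × Module.Dual k A) : B (h x) (h y) = x.2 y.1 + y.2 x.1 := by
    simp only [h, LinearMap.coprod_apply, map_add, LinearMap.add_apply, hiso, hβα, hβ,
      hq.1 (α _) (β _)]
    ring
  have hnd (x : A × Module.Dual k A) (hx : ∀ y, B (h x) (h y) = 0) : x = 0 := by
    refine Prod.ext ?_ ?_
    · refine (Module.forall_dual_apply_eq_zero_iff k x.1).1 fun g => ?_
      simpa [hB] using hx (0, g)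
    · ext a
      simpa [hB] using hx (a, 0)
  have hinj : Function.Injective h := by
    rw [injective_iff_map_eq_zero]
    exact fun x hx => hnd x fun y => by rw [hx, map_zero, LinearMap.zero_apply]
  set H := LinearMap.range h with hH
  have hcompl : IsCompl H (B.orthogonal H) := by
    refine LinearMap.BilinForm.isCompl_orthogonal_of_restrict_nondegenerate hrefl ?_
    have hsep : ∀ x : H, (∀ y : H, B x y = 0) → x = 0 := by
      rintro ⟨_, x, rfl⟩ hx
      have : x = 0 := hnd x fun y => hx ⟨h y, y, rfl⟩
      subst this
      exact Subtype.ext (map_zero h)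
    exact ⟨fun x hx => hsep x hx, fun x hx => hsep x fun y => by rw [hq.1]; exact hx y⟩
  set U := B.orthogonal H with hU
  let Ψ : ((A × Module.Dual k A) × U) ≃ₗ[k] V :=
    ((LinearEquiv.ofInjective h hinj).prodCongr (LinearEquiv.refl k U)).trans
      (Submodule.prodEquivOfIsCompl H U hcompl)
  have hΨ (x) : Ψ x = h x.1 + x.2 := rfl
  have hfr : Module.finrank k U = Fintype.card J := by
    have := Ψ.finrank_eq
    rw [Module.finrank_prod, Module.finrank_prod, Subspace.dual_finrank_eq] at this
    omega
  have hinv : Invertible (2 : k) := invertibleOfNonzero hchar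
  obtain ⟨v, hv⟩ := LinearMap.BilinForm.exists_orthogonal_basis (B := B.restrict U)
    ⟨fun x y => hq.1 x y⟩
  let w : Module.Basis J k U := v.reindex ((finCongr hfr).trans (Fintype.equivFin J).symm)
  have hw (i j : J) (hij : i ≠ j) : B (w i) (w j) = 0 := by
    simp only [w, Module.Basis.reindex_apply]
    exact hv (by simpa using hij)
  have hBU (x y : U) : B x y = ∑ j, B (w j) (w j) * w.equivFun x j * w.equivFun y j := by
    classical
    conv_lhs => rw [← w.sum_equivFun x, ← w.sum_equivFun y]
    simp only [Submodule.coe_sum, Submodule.coe_smul, map_sum, LinearMap.sum_apply, map_smul,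
      LinearMap.smul_apply, smul_eq_mul]
    refine Finset.sum_congr rfl fun i _ => ?_
    rw [Finset.sum_eq_single i (fun j _ hj => by simp [hw _ _ hj]) (by simp)]
    ring
  refine ⟨fun j => B (w j) (w j), Ψ.symm.trans ((LinearEquiv.refl k _).prodCongr w.equivFun),
    fun x y => ?_⟩
  obtain ⟨x, rfl⟩ := Ψ.surjective x
  obtain ⟨y, rfl⟩ := Ψ.surjective y
  simp only [LinearEquiv.trans_apply, LinearEquiv.symm_apply_apply, LinearEquiv.prodCongr_apply,
    LinearEquiv.refl_apply]
  rw [← hBU, ← hB, hΨ, hΨ]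
  have hort (a : A × Module.Dual k A) (u : U) : B (h a) u = 0 := u.2 (h a) ⟨a, rfl⟩
  simp only [map_add, LinearMap.add_apply, hort, hq.1 (x.2 : V) (h _)]
  ring

end Witt

namespace ModuleData

variable (D : ModuleData k)

theorem coeff_zero_ne_zero (i : D.ι) : (D.f i).coeff 0 ≠ 0 := by
  obtain ⟨σ, hσ⟩ := D.selfdual
  intro h
  have := (hσ i).1
  rw [starPoly, h, inv_zero, C_0, zero_mul] at this
  exact (D.monic (σ i)).ne_zero this

/-- The indices `i` such that `f i` is the chosen member of the pair `{f i, (f i)*}`, with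
`f i ≠ (f i)*`. -/
abbrev Half : Type := {i : D.ι // WellOrderingRel (D.f i) (starPoly (D.f i))}

/-- The indices `i` such that `f i` is self-dual. -/
abbrev SelfDual : Type := {i : D.ι // D.f i = starPoly (D.f i)}

instance : Fintype D.Half := Fintype.ofFinite _

instance : Fintype D.SelfDual := Fintype.ofFinite _

/-- Duality identifies the index set with two copies of `Half` and one of `SelfDual`. -/
def splitFun (σ : Equiv.Perm D.ι) : (D.Half ⊕ D.Half) ⊕ D.SelfDual → D.ι :=
  Sum.elim (Sum.elim (fun i => i.1) fun i => σ i.1) fun i => i.1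

variable {D}

theorem starPoly_f_perm {σ : Equiv.Perm D.ι} (hσ : ∀ i, D.f (σ i) = starPoly (D.f i)) (i : D.ι) :
    starPoly (D.f (σ i)) = D.f i := by
  rw [hσ, starPoly_starPoly (D.monic i) (D.coeff_zero_ne_zero i)]

theorem splitFun_bijective {σ : Equiv.Perm D.ι} (hσ : ∀ i, D.f (σ i) = starPoly (D.f i)) :
    Function.Bijective (D.splitFun σ) := by
  have hσ' := starPoly_f_perm hσ
  have hirr (f : k[X]) : ¬ WellOrderingRel f f := irrefl f
  have hasymm {f g : k[X]} (h : WellOrderingRel f g) : ¬ WellOrderingRel g f := asymm h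
  constructor
  · rintro ((⟨i, hi⟩ | ⟨i, hi⟩) | ⟨i, hi⟩) ((⟨j, hj⟩ | ⟨j, hj⟩) | ⟨j, hj⟩) h <;>
      simp only [splitFun, Sum.elim_inl, Sum.elim_inr, EmbeddingLike.apply_eq_iff_eq] at h <;>
      subst h
    · rfl
    · rw [hσ', hσ] at hi
      exact absurd hi (hasymm hj)
    · rw [← hj] at hi
      exact absurd hi (hirr _)
    · rw [hσ', hσ] at hj
      exact absurd hj (hasymm hi)
    · rfl
    · rw [hσ', hσ] at hj
      rw [hj] at hi
      exact absurd hi (hirr _)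
    · rw [← hi] at hj
      exact absurd hj (hirr _)
    · rw [hσ', hσ] at hi
      rw [hi] at hj
      exact absurd hj (hirr _)
    · rfl
  · intro i
    rcases trichotomous_of WellOrderingRel (D.f i) (starPoly (D.f i)) with h | h | h
    · exact ⟨.inl (.inl ⟨i, h⟩), rfl⟩
    · exact ⟨.inr ⟨i, h⟩, rfl⟩
    · obtain ⟨j, rfl⟩ := σ.surjective i
      rw [hσ', hσ] at h
      exact ⟨.inl (.inr ⟨j, h⟩), rfl⟩

theorem dim_eq_and_dim2_eq (hss : D.Semisimple) :
    D.dim = 2 * ∑ i : D.Half, D.n i.1 * (D.f i.1).natDegree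
        + ∑ i : D.SelfDual, D.n i.1 * (D.f i.1).natDegree ∧
      D.dim2 = 2 * ∑ i : D.Half, D.n i.1 * (D.f i.1).natDegree := by
  classical
  obtain ⟨σ, hσ⟩ := D.selfdual
  have hb := splitFun_bijective fun i => (hσ i).1
  have hdeg (i : D.ι) : (D.f (σ i)).natDegree = (D.f i).natDegree := by
    rw [(hσ i).1, natDegree_starPoly (D.coeff_zero_ne_zero i)]
  have hne (i : D.Half) : D.f i.1 ≠ starPoly (D.f i.1) := fun h => by
    have := i.2
    rw [← h] at this
    exact irrefl _ this
  constructor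
  · rw [dim, ← hb.sum_comp]
    simp only [splitFun, Fintype.sum_sum_type, Sum.elim_inl, Sum.elim_inr, hss _, one_mul,
      hdeg, (hσ _).2.2]
    ring
  · rw [dim2, ← hb.sum_comp]
    simp only [IsIdx2, splitFun, Fintype.sum_sum_type, Sum.elim_inl, Sum.elim_inr, hss _, one_mul,
      hdeg, (hσ _).2.2, starPoly_f_perm fun i => (hσ i).1]
    simp only [(hσ _).1, ne_eq, fun i => (hne i).symm, hne, fun i : D.SelfDual => i.2.symm,
      not_false_eq_true, if_true, not_true_eq_false, if_false, Finset.sum_const_zero]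
    ring

/-- The `i`-th isotypic summand of the module. -/
abbrev Component (D : ModuleData k) (i : D.ι) : Type :=
  Fin (D.n i) → k[X] ⧸ Ideal.span {((D.f i).map (RingHom.id k)) ^ D.e i}

theorem span_eq (hss : D.Semisimple) (i : D.ι) :
    Ideal.span {((D.f i).map (RingHom.id k)) ^ D.e i} = Ideal.span {D.f i} := by
  rw [hss, pow_one, Polynomial.map_id]

theorem finite_quotient_span (hss : D.Semisimple) (i : D.ι) :
    Module.Finite k (k[X] ⧸ Ideal.span {((D.f i).map (RingHom.id k)) ^ D.e i}) := by
  rw [span_eq hss]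
  exact (D.monic i).finite_quotient

theorem finiteDimensional_component (hss : D.Semisimple) (i : D.ι) :
    FiniteDimensional k (D.Component i) :=
  have := finite_quotient_span hss i
  inferInstance

theorem finrank_component (hss : D.Semisimple) (i : D.ι) :
    Module.finrank k (D.Component i) = D.n i * (D.f i).natDegree := by
  have := finite_quotient_span hss i
  rw [Module.finrank_pi_fintype]
  simp [finrank_quotient_span_eq_natDegree, hss i]

theorem smul_component_eq_zero (hss : D.Semisimple) (i : D.ι) {p : k[X]} (hp : D.f i ∣ p)
    (x : D.Component i) : p • x = 0 := by
  funext j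
  obtain ⟨q, hq⟩ := Ideal.Quotient.mk_surjective (x j)
  rw [Pi.smul_apply, ← hq, Pi.zero_apply, ← Ideal.Quotient.mk_eq_mk, ← Submodule.Quotient.mk_smul,
    Ideal.Quotient.mk_eq_mk, Ideal.Quotient.eq_zero_iff_mem, span_eq hss, smul_eq_mul]
  exact Ideal.mul_mem_right _ _ (Ideal.mem_span_singleton.2 hp)

theorem finrank_half (hss : D.Semisimple) :
    Module.finrank k ((i : D.Half) → D.Component i.1) =
      ∑ i : D.Half, D.n i.1 * (D.f i.1).natDegree := by
  have := fun i => finiteDimensional_component hss (D := D) i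
  rw [Module.finrank_pi_fintype]
  simp only [finrank_component hss]

/-- Multiplication by `X` on a component. -/
def mulX (D : ModuleData k) (i : D.ι) : Module.End k (D.Component i) :=
  Algebra.lsmul k k (D.Component i) (X : k[X])

theorem aeval_mulX_f (hss : D.Semisimple) (i : D.ι) : aeval (D.mulX i) (D.f i) = 0 := by
  refine LinearMap.ext fun x => ?_
  exact (apply_aeval_of_intertwines LinearMap.id (D.mulX i) (fun _ => rfl) (D.f i) x).trans
    (smul_component_eq_zero hss i dvd_rfl x)

/-- Multiplication by `X` on a component, as an automorphism. -/
def mulXEquiv (hss : D.Semisimple) (i : D.ι) : D.Component i ≃ₗ[k] D.Component i :=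
  haveI := finiteDimensional_component hss i
  LinearEquiv.ofInjectiveEndo (D.mulX i)
    (injective_of_aeval_eq_zero _ (aeval_mulX_f hss i) (D.coeff_zero_ne_zero i))

/-- The dual of the component of index `i`, with the inverse transpose action of `X`, is the
component of the dual index. -/
theorem exists_dual_component_equiv (hss : D.Semisimple) {i j : D.ι}
    (hf : D.f j = starPoly (D.f i)) (hn : D.n j = D.n i) :
    ∃ e : Module.Dual k (D.Component i) ≃ₗ[k] D.Component j,
      ∀ ψ, e (ψ ∘ₗ (mulXEquiv hss i).symm.toLinearMap) = (X : k[X]) • e ψ := by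
  have := finiteDimensional_component hss i
  let τ : Module.End k (Module.Dual k (D.Component i)) :=
    (mulXEquiv hss i).symm.toLinearMap.dualMap
  have hpair (x : D.Component i) (ψ : Module.Dual k (D.Component i)) :
      Module.Dual.eval k _ (D.mulX i x) (τ ψ) = Module.Dual.eval k _ x ψ :=
    congrArg ψ ((mulXEquiv hss i).symm_apply_apply x)
  refine exists_equiv_pi_quotient τ (D.irr j) ?_ ?_ (span_eq hss j)
  · have hrev : aeval τ (D.f i).reverse = 0 := by
      refine LinearMap.ext fun ψ => LinearMap.ext fun x => ?_
      exact (pairing_aeval_reverse _ _ τ hpair (D.f i) x ψ).symm.trans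
        (by rw [aeval_mulX_f hss, LinearMap.zero_apply, map_zero]; rfl)
    rw [hf, starPoly, map_mul, hrev, mul_zero]
  · rw [Subspace.dual_finrank_eq, finrank_component hss, hn, hf,
      natDegree_starPoly (D.coeff_zero_ne_zero i)]

/-- A space with scalar action of `X` by `ε` is a component of type 0. -/
theorem exists_scalar_component_equiv (hss : D.Semisimple) (i : D.ι) {ε : k}
    (hf : D.f i = X - C ε) :
    ∃ e : (Fin (D.n i) → k) ≃ₗ[k] D.Component i, ∀ u, e (ε • u) = (X : k[X]) • e u :=
  exists_equiv_pi_quotient (algebraMap k (Module.End k (Fin (D.n i) → k)) ε) (D.irr i)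
    (by rw [hf, map_sub, aeval_X, aeval_C, sub_self])
    (by rw [hf, natDegree_X_sub_C, Module.finrank_fin_fun, mul_one]) (span_eq hss i)

/-- Extension by zero from the components in `Half`. -/
def extendHalf (D : ModuleData k) :
    ((i : D.Half) → D.Component i.1) →ₗ[k] ((i : D.ι) → D.Component i) := by
  classical
  exact LinearMap.pi fun i => if h : WellOrderingRel (D.f i) (starPoly (D.f i)) then
    LinearMap.proj (⟨i, h⟩ : D.Half) else 0

theorem extendHalf_apply (a : (i : D.Half) → D.Component i.1) (i : D.Half) :
    D.extendHalf a i.1 = a i := by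
  simp [extendHalf, i.2]

theorem extendHalf_injective : Function.Injective D.extendHalf := fun a b h => by
  funext i
  exact (extendHalf_apply a i).symm.trans ((congrFun h i.1).trans (extendHalf_apply b i))

/-- The product of the polynomials indexed by `Half`. -/
def halfPoly (D : ModuleData k) : k[X] := ∏ i : D.Half, D.f i.1

theorem halfPoly_smul_extendHalf (hss : D.Semisimple) (a : (i : D.Half) → D.Component i.1) :
    D.halfPoly • D.extendHalf a = 0 := by
  funext i
  by_cases h : WellOrderingRel (D.f i) (starPoly (D.f i))
  · have hdvd : D.f i ∣ D.halfPoly :=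
      Finset.dvd_prod_of_mem (fun i : D.Half => D.f i.1) (Finset.mem_univ (⟨i, h⟩ : D.Half))
    rw [Pi.smul_apply, Pi.zero_apply]
    exact smul_component_eq_zero hss i hdvd (D.extendHalf a i)
  · have h0 : D.extendHalf a i = 0 := by simp [extendHalf, h]
    rw [Pi.smul_apply, h0, smul_zero, Pi.zero_apply]

theorem isCoprime_halfPoly_reverse : IsCoprime D.halfPoly D.halfPoly.reverse := by
  have hrev (s : Finset D.Half) : (∏ i ∈ s, D.f i.1).reverse = ∏ i ∈ s, (D.f i.1).reverse := by
    classical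
    induction s using Finset.induction_on with
    | empty => rw [Finset.prod_empty, Finset.prod_empty, ← C_1, reverse_C]
    | insert i s hi ih =>
      rw [Finset.prod_insert hi, reverse_mul_of_domain, ih, Finset.prod_insert hi]
  rw [halfPoly, hrev]
  refine IsCoprime.prod_left fun i _ => IsCoprime.prod_right fun j _ => ?_
  rw [isCoprime_reverse_iff (D.coeff_zero_ne_zero _)]
  obtain ⟨σ, hσ⟩ := D.selfdual
  rw [← (hσ j).1, (D.irr _).coprime_iff_not_dvd]
  intro hdvd
  have h := eq_of_monic_of_associated (D.monic _) (D.monic _)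
    ((D.irr _).associated_of_dvd (D.irr _) hdvd)
  have hi := i.2
  rw [h, starPoly_f_perm fun i => (hσ i).1, (hσ j).1] at hi
  exact asymm hi j.2

/-- Multiplication by `X` on the sum of the components in `Half`. -/
def mulXHalf (hss : D.Semisimple) :
    ((i : D.Half) → D.Component i.1) ≃ₗ[k] ((i : D.Half) → D.Component i.1) :=
  LinearEquiv.piCongrRight fun i => mulXEquiv hss i.1

theorem exists_dual_half_equiv (hss : D.Semisimple) {σ : Equiv.Perm D.ι}
    (hf : ∀ i, D.f (σ i) = starPoly (D.f i)) (hn : ∀ i, D.n (σ i) = D.n i) :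
    ∃ e : Module.Dual k ((i : D.Half) → D.Component i.1) ≃ₗ[k]
        ((i : D.Half) → D.Component (σ i.1)),
      ∀ ψ, e (ψ ∘ₗ (mulXHalf hss).symm.toLinearMap) = (X : k[X]) • e ψ := by
  classical
  choose e he using fun i : D.Half => exists_dual_component_equiv hss (hf i.1) (hn i.1)
  refine ⟨(LinearMap.lsum k (fun i : D.Half => D.Component i.1) k).symm.trans
    (LinearEquiv.piCongrRight e), fun ψ => ?_⟩
  funext i
  refine Eq.trans ?_ (he i (ψ ∘ₗ LinearMap.single k (fun i : D.Half => D.Component i.1) i))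
  refine congrArg (e i) (LinearMap.ext fun x => congrArg ψ ?_)
  rw [LinearEquiv.coe_coe, LinearEquiv.symm_apply_eq]
  funext j
  rcases eq_or_ne j i with rfl | hj
  · simp [mulXHalf]
  · simp [mulXHalf, hj]

theorem exists_scalar_selfDual_equiv (hss : D.Semisimple) {ε : D.SelfDual → k}
    (hf : ∀ i, D.f i.1 = X - C (ε i)) :
    ∃ e : ((Σ i : D.SelfDual, Fin (D.n i.1)) → k) ≃ₗ[k]
        ((i : D.SelfDual) → D.Component i.1),
      ∀ u, e (fun j => ε j.1 * u j) = (X : k[X]) • e u := by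
  choose e he using fun i : D.SelfDual => exists_scalar_component_equiv hss i.1 (hf i)
  exact ⟨(LinearEquiv.piCurry k fun _ _ => k).trans (LinearEquiv.piCongrRight e),
    fun u => funext fun i => he i fun j => u ⟨i, j⟩⟩

/-- Restriction of an element of the module to `Half`, its dual, and the self-dual part. -/
def splitMap (D : ModuleData k) (σ : Equiv.Perm D.ι) :
    ((i : D.ι) → D.Component i) →ₗ[k[X]]
      (((i : D.Half) → D.Component i.1) × ((i : D.Half) → D.Component (σ i.1))) ×
        ((i : D.SelfDual) → D.Component i.1) :=
  ((LinearMap.pi fun i : D.Half => LinearMap.proj i.1).prod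
    (LinearMap.pi fun i : D.Half => LinearMap.proj (σ i.1))).prod
    (LinearMap.pi fun i : D.SelfDual => LinearMap.proj i.1)

theorem splitMap_bijective {σ : Equiv.Perm D.ι} (hσ : ∀ i, D.f (σ i) = starPoly (D.f i)) :
    Function.Bijective (D.splitMap σ) := by
  have hb := splitFun_bijective hσ
  constructor
  · intro m m' h
    funext i
    obtain ⟨(i | i) | i, rfl⟩ := hb.surjective i
    · exact congrFun (congrArg (fun z => z.1.1) h) i
    · exact congrFun (congrArg (fun z => z.1.2) h) i
    · exact congrFun (congrArg (fun z => z.2) h) i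
  · rintro ⟨⟨a, b⟩, c⟩
    let F : (x : (D.Half ⊕ D.Half) ⊕ D.SelfDual) → D.Component (D.splitFun σ x)
      | .inl (.inl i) => a i
      | .inl (.inr i) => b i
      | .inr i => c i
    obtain ⟨m, hm⟩ := (Equiv.piCongrLeft D.Component (Equiv.ofBijective _ hb)).symm.surjective F
    exact ⟨m, Prod.ext (Prod.ext (funext fun i => congrFun hm (.inl (.inl i)))
      (funext fun i => congrFun hm (.inl (.inr i)))) (funext fun i => congrFun hm (.inr i))⟩

/-- The module splits as the sum over `Half`, its dual, and the self-dual part. -/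
def splitEquiv {σ : Equiv.Perm D.ι} (hσ : ∀ i, D.f (σ i) = starPoly (D.f i)) :
    ((((i : D.Half) → D.Component i.1) × ((i : D.Half) → D.Component (σ i.1))) ×
      ((i : D.SelfDual) → D.Component i.1)) ≃ₗ[k[X]] ((i : D.ι) → D.Component i) :=
  (LinearEquiv.ofBijective (D.splitMap σ) (splitMap_bijective hσ)).symm

end ModuleData

section Main

open ModuleData

variable {V : Type} [AddCommGroup V] [Module k V] [FiniteDimensional k V]

theorem le_wittIndex_of_hasIsometryWithModule {D : ModuleData k} (hss : D.Semisimple)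
    (B : LinearMap.BilinForm k V) (h : HasIsometryWithModule B D) :
    ∑ i : D.Half, D.n i.1 * (D.f i.1).natDegree ≤ wittIndex B := by
  obtain ⟨t, ht, φ, hφ⟩ := h
  let W : Submodule k V := LinearMap.ker (aeval t.toLinearMap D.halfPoly)
  have hW : ∀ x ∈ W, ∀ y ∈ W, B x y = 0 := fun x hx y hy =>
    apply_eq_zero_of_aeval_eq_zero B t.toLinearMap ht isCoprime_halfPoly_reverse hx hy
  refine le_trans ?_ (finrank_le_wittIndex B W hW)
  have hmem (a : (i : D.Half) → D.Component i.1) : φ.symm (D.extendHalf a) ∈ W := by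
    refine φ.injective ?_
    have := apply_aeval_of_intertwines φ.toLinearMap t.toLinearMap hφ D.halfPoly
      (φ.symm (D.extendHalf a))
    rw [LinearEquiv.coe_coe, φ.apply_symm_apply] at this
    exact this.trans ((halfPoly_smul_extendHalf hss a).trans φ.map_zero.symm)
  rw [← finrank_half hss]
  exact LinearMap.finrank_le_finrank_of_injective
    (f := (φ.symm.toLinearMap ∘ₗ D.extendHalf).codRestrict W hmem) fun a b hab =>
      extendHalf_injective (φ.symm.injective (congrArg Subtype.val hab))

theorem hasIsometryWithModule_of_le_wittIndex (hchar : (2 : k) ≠ 0) {D : ModuleData k}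
    (hss : D.Semisimple) (hM1 : ∀ i, ¬ D.IsIdx1 i) (B : LinearMap.BilinForm k V)
    (hq : IsQuadraticSpace B) (hdim : Module.finrank k V = D.dim)
    (h : ∑ i : D.Half, D.n i.1 * (D.f i.1).natDegree ≤ wittIndex B) :
    HasIsometryWithModule B D := by
  obtain ⟨W, hW, hWf⟩ := exists_isotropic_finrank_eq B h
  have hfin := finiteDimensional_component (D := D) hss
  let A := (i : D.Half) → D.Component i.1
  let α : A ≃ₗ[k] W := LinearEquiv.ofFinrankEq _ _ ((finrank_half hss).trans hWf.symm)
  have hε' (i : D.SelfDual) : ∃ ε : k, ε * ε = 1 ∧ D.f i.1 = X - C ε :=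
    exists_eq_X_sub_C_of_eq_starPoly hchar (D.monic _) (D.irr _) (D.coeff_zero_ne_zero _) i.2
      (hM1 i)
  choose ε hε hfε using hε'
  obtain ⟨c, Φ, hΦ⟩ := exists_witt_decomposition hchar B hq (A := A) (W.subtype ∘ₗ α.toLinearMap)
    (W.injective_subtype.comp α.injective) (fun a b => hW _ (α a).2 _ (α b).2)
    (J := Σ i : D.SelfDual, Fin (D.n i.1)) (by
      rw [hdim, (dim_eq_and_dim2_eq hss).1, finrank_half hss, Fintype.card_sigma]
      simp [hfε])
  obtain ⟨σ, hσ⟩ := D.selfdual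
  obtain ⟨eD, heD⟩ := exists_dual_half_equiv hss (fun i => (hσ i).1) fun i => (hσ i).2.2
  obtain ⟨eS, heS⟩ := exists_scalar_selfDual_equiv hss hfε
  have hε0 (i : D.SelfDual) : ε i ≠ 0 := fun h0 => by simpa [h0] using hε i
  let s : A ≃ₗ[k] A := mulXHalf hss
  let T :=
    (s.prodCongr s.symm.dualMap).prodCongr
      (LinearEquiv.piCongrRight fun j : Σ i : D.SelfDual, Fin (D.n i.1) =>
        LinearEquiv.smulOfNeZero k k (ε j.1) (hε0 j.1))
  have hT (x) : T x = ((s x.1.1, x.1.2 ∘ₗ s.symm.toLinearMap), fun j => ε j.1 * x.2 j) := rfl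
  refine ⟨(Φ.trans T).trans Φ.symm, fun x y => ?_,
    Φ.trans ((((LinearEquiv.refl k A).prodCongr eD).prodCongr eS).trans
      ((splitEquiv fun i => (hσ i).1).restrictScalars k)), fun v => ?_⟩
  · rw [hΦ, hΦ]
    simp only [LinearEquiv.trans_apply, LinearEquiv.apply_symm_apply, hT, LinearMap.comp_apply,
      LinearEquiv.coe_coe, LinearEquiv.symm_apply_apply]
    congr 1
    refine Finset.sum_congr rfl fun j _ => ?_
    linear_combination c j * (Φ x).2 j * (Φ y).2 j * hε j.1
  · simp only [LinearEquiv.trans_apply, LinearEquiv.apply_symm_apply, hT,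
      LinearEquiv.prodCongr_apply, LinearEquiv.refl_apply, heD, heS,
      LinearEquiv.restrictScalars_apply, s]
    exact map_smul (splitEquiv fun i => (hσ i).1) (X : k[X])
      (((Φ v).1.1, eD (Φ v).1.2), eS (Φ v).2)

end Main

/-- **Prop. 4.3.** For a semi-simple module `M` with `M¹ = 0` and a
quadratic space `q` with `dim q = dim_k M` : `q` has an isometry with module `M` iff
the Witt index of `q` is at least `m₂`, where `2m₂ = dim_k M²`. -/
theorem hasIsometryWithModule_iff_wittIndex
    (hchar : (2 : k) ≠ 0)
    (D : ModuleData k) (hss : D.Semisimple) (hM1 : ∀ i, ¬ D.IsIdx1 i)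
    {V : Type} [AddCommGroup V] [Module k V] [FiniteDimensional k V]
    (B : LinearMap.BilinForm k V) (hq : IsQuadraticSpace B)
    (hdim : Module.finrank k V = D.dim)
    (m₂ : ℕ) (hm₂ : 2 * m₂ = D.dim2) :
    HasIsometryWithModule B D ↔ m₂ ≤ wittIndex B := by
  have hm : m₂ = ∑ i : D.Half, D.n i.1 * (D.f i.1).natDegree :=
    Nat.eq_of_mul_eq_mul_left two_pos (hm₂.trans (ModuleData.dim_eq_and_dim2_eq hss).2)
  rw [hm]
  exact ⟨le_wittIndex_of_hasIsometryWithModule hss B,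
    hasIsometryWithModule_of_le_wittIndex hchar hss hM1 B hq hdim⟩

end
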